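/- The number of words over the alphabet {R, U, D} consisting of exactly k letters R, k letters U, and n − k letters D, whose first letter is not D, and in which every occurrence of D has some R occurring before it, equals binomial(n + k, k) · binomial(n − 1, k − 1). -/

import Mathlib

inductive Letter : Type
  | R | U | D
deriving DecidableEq

instance : Finite Letter :=
  Finite.of_injective (β := Fin 3) (fun x => match x with | .R => 0 | .U => 1 | .D => 2) (by
    intro x y; cases x <;> cases y <;> simp)

namespace Letter

/-- The words with `a` letters R, `b` letters U and `c` letters D. -/
def words (a b c : ℕ) : Set (List Letter) :=
  {w | w.count R = a ∧ w.count U = b ∧ w.count D = c}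

/-- Every occurrence of D has some R before it. -/
def RBeforeD (w : List Letter) : Prop :=
  ∀ u v : List Letter, w = u ++ D :: v → R ∈ u

theorem length_eq_count_add (w : List Letter) :
    w.length = w.count R + w.count U + w.count D := by
  induction w with
  | nil => simp
  | cons x w ih => cases x <;> simp [ih] <;> omega

theorem finite_words (a b c : ℕ) : (words a b c).Finite := by
  refine (List.finite_length_eq Letter (a + b + c)).subset ?_
  rintro w ⟨rfl, rfl, rfl⟩
  exact length_eq_count_add w

theorem ncard_eq_sum_cons {T : Set (List Letter)} (hT : T.Finite) (h : [] ∉ T) :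
    T.ncard = {w | R :: w ∈ T}.ncard + {w | U :: w ∈ T}.ncard + {w | D :: w ∈ T}.ncard := by
  have key : ∀ x : Letter, {w | x :: w ∈ T}.ncard = (List.cons x '' {w | x :: w ∈ T}).ncard :=
    fun x => (Set.ncard_image_of_injective _ List.cons_injective).symm
  have sub : ∀ x : Letter, List.cons x '' {w | x :: w ∈ T} ⊆ T := by
    rintro x _ ⟨w, hw, rfl⟩
    exact hw
  rw [key R, key U, key D, ← Set.ncard_union_eq _ (hT.subset (sub R)) (hT.subset (sub U)),
    ← Set.ncard_union_eq _ ((hT.subset (sub R)).union (hT.subset (sub U))) (hT.subset (sub D))]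
  · congr 1
    ext w
    rcases w with _ | ⟨x, w⟩
    · simpa using h
    · cases x <;> simp
  · rw [Set.disjoint_left]
    rintro _ (⟨w, -, rfl⟩ | ⟨w, -, rfl⟩) <;> simp
  · rw [Set.disjoint_left]
    rintro _ ⟨w, -, rfl⟩
    simp

open Nat in
theorem ncard_words_mul_factorial (a b c : ℕ) :
    (words a b c).ncard * (a ! * b ! * c !) = (a + b + c)! := by
  induction hs : a + b + c generalizing a b c with
  | zero =>
    obtain ⟨rfl, rfl, rfl⟩ : a = 0 ∧ b = 0 ∧ c = 0 := by omega
    have : words 0 0 0 = {[]} := by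
      ext w
      constructor
      · rintro ⟨h1, h2, h3⟩
        have := length_eq_count_add w
        simpa [h1, h2, h3] using this
      · rintro rfl
        simp [words]
    simp [this]
  | succ s ih =>
    have hnil : [] ∉ words a b c := by
      simp only [words, Set.mem_ofPred_eq, List.count_nil]
      omega
    have hR : {w | R :: w ∈ words a b c}.ncard * (a ! * b ! * c !) = a * s ! := by
      rcases a with _ | a
      · simp [words]
      · have : {w | R :: w ∈ words (a + 1) b c} = words a b c := by simp [words]
        rw [this, ← ih a b c (by omega), factorial_succ]
        ring
    have hU : {w | U :: w ∈ words a b c}.ncard * (a ! * b ! * c !) = b * s ! := by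
      rcases b with _ | b
      · simp [words]
      · have : {w | U :: w ∈ words a (b + 1) c} = words a b c := by simp [words]
        rw [this, ← ih a b c (by omega), factorial_succ]
        ring
    have hD : {w | D :: w ∈ words a b c}.ncard * (a ! * b ! * c !) = c * s ! := by
      rcases c with _ | c
      · simp [words]
      · have : {w | D :: w ∈ words a b (c + 1)} = words a b c := by simp [words]
        rw [this, ← ih a b c (by omega), factorial_succ]
        ring
    rw [ncard_eq_sum_cons (finite_words a b c) hnil, add_mul, add_mul, hR, hU, hD,
      factorial_succ, ← hs]
    ring

open Nat in
theorem ncard_words (a b c : ℕ) :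
    (words a b c).ncard = (a + c + b).choose b * (a + c).choose a := by
  have h : 0 < a ! * b ! * c ! := by positivity
  refine Nat.eq_of_mul_eq_mul_right h ?_
  rw [ncard_words_mul_factorial, show a + b + c = a + c + b by ring,
    ← Nat.add_choose_mul_factorial_mul_factorial (a + c) b,
    ← Nat.add_choose_mul_factorial_mul_factorial a c,
    Nat.choose_symm_add (a := a) (b := c)]
  ring

theorem rBeforeD_cons_R (w : List Letter) : RBeforeD (R :: w) := by
  rintro (_ | ⟨x, u⟩) v h <;> simp_all

theorem rBeforeD_cons_U (w : List Letter) : RBeforeD (U :: w) ↔ RBeforeD w := by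
  constructor
  · intro h u v hw
    simpa using h (U :: u) v (by simp [hw])
  · rintro h (_ | ⟨x, u⟩) v hw
    · simp at hw
    · rw [List.cons_append, List.cons.injEq] at hw
      exact List.mem_cons_of_mem _ (h u v hw.2)

theorem not_rBeforeD_cons_D (w : List Letter) : ¬ RBeforeD (D :: w) :=
  fun h => by simpa using h [] w rfl

theorem ncard_words_rBeforeD (a b c : ℕ) :
    {w ∈ words (a + 1) b c | RBeforeD w}.ncard =
      (a + 1 + c + b).choose b * (a + c).choose a := by
  have hfin : ∀ b, {w ∈ words (a + 1) b c | RBeforeD w}.Finite :=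
    fun b => (finite_words _ b _).subset (Set.sep_subset _ _)
  have hnil : ∀ b, [] ∉ {w ∈ words (a + 1) b c | RBeforeD w} := by
    simp [words]
  have hR : ∀ b, {w | R :: w ∈ {w ∈ words (a + 1) b c | RBeforeD w}} = words a b c := by
    simp [words, rBeforeD_cons_R]
  have hD : ∀ b, {w | D :: w ∈ {w ∈ words (a + 1) b c | RBeforeD w}} = ∅ := by
    simp [not_rBeforeD_cons_D]
  induction b with
  | zero =>
    have hU : {w | U :: w ∈ {w ∈ words (a + 1) 0 c | RBeforeD w}} = ∅ := by
      simp [words]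
    rw [ncard_eq_sum_cons (hfin 0) (hnil 0), hR, hD, hU, ncard_words]
    simp
  | succ b ih =>
    have hU : {w | U :: w ∈ {w ∈ words (a + 1) (b + 1) c | RBeforeD w}} =
        {w ∈ words (a + 1) b c | RBeforeD w} := by
      simp [words, rBeforeD_cons_U]
    rw [ncard_eq_sum_cons (hfin _) (hnil _), hR, hD, hU, ncard_words, ih, Set.ncard_empty,
      show a + 1 + c + (b + 1) = (a + c + (b + 1)) + 1 by ring, Nat.choose_succ_succ,
      show a + 1 + c + b = a + c + (b + 1) by ring]
    ring

end Letter

open Letter in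
/-- The number of words over {R, U, D} with exactly `k` letters R, `k` letters U and
`n - k` letters D, whose first letter is not D, and in which every occurrence of D
has some R before it, equals `(n + k).choose k * (n - 1).choose (k - 1)`. -/
theorem stmt_1 (n k : ℕ) (hk : 1 ≤ k) (hkn : k ≤ n) :
    Set.ncard {w : List Letter |
        w.count R = k ∧ w.count U = k ∧ w.count D = n - k ∧
        w.head? ≠ some D ∧ (∀ u v : List Letter, w = u ++ D :: v → R ∈ u)} =
      (n + k).choose k * (n - 1).choose (k - 1) := by
  obtain ⟨a, rfl⟩ := Nat.exists_eq_add_of_le' hk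
  obtain ⟨c, rfl⟩ := Nat.exists_eq_add_of_le hkn
  rw [Nat.add_sub_cancel_left, Nat.add_sub_cancel, show a + 1 + c - 1 = a + c by omega,
    ← ncard_words_rBeforeD]
  congr 1
  ext w
  constructor
  · rintro ⟨h1, h2, h3, -, h⟩
    exact ⟨⟨h1, h2, h3⟩, h⟩
  · rintro ⟨⟨h1, h2, h3⟩, h⟩
    refine ⟨h1, h2, h3, fun hD => ?_, h⟩
    obtain ⟨v, rfl⟩ := List.head?_eq_some_iff.mp hD
    exact not_rBeforeD_cons_D v h
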